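/- (Hoare's axiomatization of static valuation congruence) For all propositional statements P and Q: CP_st ⊢ P = Q if and only if P =_st Q, where CP_st is CP extended with the axioms (CPstat) (x◁y▷z)◁u▷v = (x◁u▷v)◁y▷(z◁u▷v) and (CPcontr) (x◁y▷z)◁y▷u = x◁y▷u. -/

import Mathlib

/-- Propositional statements over atoms `A`: constants `T`, `F`, an atom `a`
for each `a ∈ A`, and the ternary conditional composition
`cond x y z = x ◁ y ▷ z` (with `y` the central condition). -/
inductive PS (A : Type) : Type where
  | tt : PS A
  | ff : PS A
  | atom : A → PS A
  | cond : PS A → PS A → PS A → PS A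

/-- A valuation algebra (VA) over `A`. -/
structure VA (A : Type) where
  Val : Type
  Tv : Val
  Fv : Val
  yd : A → Val → Bool
  dv : A → Val → Val
  yd_T : ∀ a, yd a Tv = true
  yd_F : ∀ a, yd a Fv = false
  dv_T : ∀ a, dv a Tv = Tv
  dv_F : ∀ a, dv a Fv = Fv

variable {A : Type}

mutual
  /-- Evaluation `P/H` of a propositional statement over a valuation `H`. -/
  def PS.eval (V : VA A) : PS A → V.Val → Bool
    | .tt, _ => true
    | .ff, _ => false
    | .atom a, H => V.yd a H
    | .cond p q r, H =>
        if PS.eval V q H then PS.eval V p (PS.deriv V q H)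
        else PS.eval V r (PS.deriv V q H)
  /-- The generalized derivative `∂_P(H)`. -/
  def PS.deriv (V : VA A) : PS A → V.Val → V.Val
    | .tt, H => H
    | .ff, H => H
    | .atom a, H => V.dv a H
    | .cond p q r, H =>
        if PS.eval V q H then PS.deriv V p (PS.deriv V q H)
        else PS.deriv V r (PS.deriv V q H)
end

/-- `K`-equivalence: equal evaluation results in all members of the class `K`. -/
def KEquiv (K : VA A → Prop) (P Q : PS A) : Prop :=
  ∀ V : VA A, K V → ∀ H : V.Val, PS.eval V P H = PS.eval V Q H

/-- A congruence with respect to conditional composition. -/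
def IsCondCongruence (R : PS A → PS A → Prop) : Prop :=
  Equivalence R ∧
    ∀ ⦃x x' y y' z z' : PS A⦄, R x x' → R y y' → R z z' →
      R (PS.cond x y z) (PS.cond x' y' z')

/-- `K`-congruence: the largest congruence contained in `K`-equivalence. -/
def KCong (K : VA A → Prop) (P Q : PS A) : Prop :=
  ∃ R : PS A → PS A → Prop,
    IsCondCongruence R ∧ (∀ x y, R x y → KEquiv K x y) ∧ R P Q

/-- Derivability (of closed equations) in equational logic from the axioms `CP`
together with an additional set `Ax` of equational axioms. -/
inductive Deriv (Ax : PS A → PS A → Prop) : PS A → PS A → Prop where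
  | ax {p q} : Ax p q → Deriv Ax p q
  | cp1 (x y) : Deriv Ax (.cond x .tt y) x
  | cp2 (x y) : Deriv Ax (.cond x .ff y) y
  | cp3 (x) : Deriv Ax (.cond .tt x .ff) x
  | cp4 (x y z u v) :
      Deriv Ax (.cond x (.cond y z u) v)
               (.cond (.cond x y v) z (.cond x u v))
  | refl (x) : Deriv Ax x x
  | symm {p q} : Deriv Ax p q → Deriv Ax q p
  | trans {p q r} : Deriv Ax p q → Deriv Ax q r → Deriv Ax p r
  | congr {x x' y y' z z'} : Deriv Ax x x' → Deriv Ax y y' → Deriv Ax z z' →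
      Deriv Ax (.cond x y z) (.cond x' y' z')

/-- No additional axioms: plain `CP`. -/
def NoAx : PS A → PS A → Prop := fun _ _ => False

/-- The class `fr` of free valuation algebras: all VAs. -/
def frK : VA A → Prop := fun _ => True

/-- The class `rp` of repetition-proof VAs. -/
def rpK (V : VA A) : Prop :=
  ∀ (a : A) (x : V.Val), V.yd a x = V.yd a (V.dv a x)

/-- The class `cr` of contractive VAs. -/
def crK (V : VA A) : Prop :=
  rpK V ∧ ∀ (a : A) (x : V.Val), V.dv a (V.dv a x) = V.dv a x

/-- The class `wm` of weakly memorizing VAs. -/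
def wmK (V : VA A) : Prop :=
  crK V ∧ ∀ (a b : A) (x : V.Val),
    V.yd b (V.dv a x) = V.yd a x →
      V.dv a (V.dv b (V.dv a x)) = V.dv b (V.dv a x) ∧
      V.yd a (V.dv b (V.dv a x)) = V.yd a x

/-- The class `mem` of memorizing VAs. -/
def memK (V : VA A) : Prop :=
  crK V ∧ ∀ (a b : A) (x : V.Val),
    V.dv a (V.dv b (V.dv a x)) = V.dv b (V.dv a x) ∧
    V.yd a (V.dv b (V.dv a x)) = V.yd a x

/-- The class `st` of static VAs. -/
def stK (V : VA A) : Prop :=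
  ∀ (a b : A) (x : V.Val), V.yd a (V.dv b x) = V.yd a x

/-- The axioms `(CPstat)` and `(CPcontr)`. -/
inductive StAx {A : Type} : PS A → PS A → Prop where
  | stat (x y z u v : PS A) :
      StAx (.cond (.cond x y z) u v)
           (.cond (.cond x u v) y (.cond z u v))
  | contr (x y z u : PS A) :
      StAx (.cond (.cond x y z) y u)
           (.cond x y u)

/-- The classical truth value of a propositional statement under an assignment of the atoms. -/
def PS.truth (f : A → Bool) : PS A → Bool
  | .tt => true
  | .ff => false
  | .atom a => f a
  | .cond p q r => if PS.truth f q then PS.truth f p else PS.truth f r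

/-- The propositional constant with a given truth value. -/
def PS.const : Bool → PS A
  | true => .tt
  | false => .ff

/-- The list of atoms occurring in a propositional statement. -/
def PS.atoms : PS A → List A
  | .tt => []
  | .ff => []
  | .atom a => [a]
  | .cond p q r => PS.atoms p ++ PS.atoms q ++ PS.atoms r

open Classical in
/-- Replace every occurrence of the atom `a` by the constant with truth value `b`. -/
noncomputable def PS.subst (a : A) (b : Bool) : PS A → PS A
  | .tt => .tt
  | .ff => .ff
  | .atom c => if c = a then PS.const b else .atom c
  | .cond p q r => .cond (PS.subst a b p) (PS.subst a b q) (PS.subst a b r)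

/-- The valuation algebra of all assignments of the atoms, with trivial derivatives. -/
def assignmentVA (A : Type) : VA A where
  Val := A → Bool
  Tv := fun _ => true
  Fv := fun _ => false
  yd a f := f a
  dv _ f := f
  yd_T _ := rfl
  yd_F _ := rfl
  dv_T _ := rfl
  dv_F _ := rfl

theorem PS.yd_deriv_of_stK {V : VA A} (hV : stK V) (a : A) (P : PS A) (H : V.Val) :
    V.yd a (PS.deriv V P H) = V.yd a H := by
  induction P generalizing H with
  | tt => simp [PS.deriv]
  | ff => simp [PS.deriv]
  | atom b => simpa [PS.deriv] using hV a b H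
  | cond p q r hp hq hr =>
    rw [PS.deriv]
    split
    · rw [hp, hq]
    · rw [hr, hq]

theorem PS.eval_of_stK {V : VA A} (hV : stK V) (P : PS A) (H : V.Val) :
    PS.eval V P H = PS.truth (fun a => V.yd a H) P := by
  induction P generalizing H with
  | tt => simp [PS.eval, PS.truth]
  | ff => simp [PS.eval, PS.truth]
  | atom b => simp [PS.eval, PS.truth]
  | cond p q r hp hq hr =>
    rw [PS.eval, PS.truth, hp, hq, hr]
    simp only [PS.yd_deriv_of_stK hV]

theorem kEquiv_stK_iff (P Q : PS A) :
    KEquiv stK P Q ↔ ∀ f : A → Bool, PS.truth f P = PS.truth f Q := by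
  constructor
  · intro h f
    have hst : stK (assignmentVA A) := fun _ _ _ => rfl
    exact (PS.eval_of_stK hst P f).symm.trans <|
      (h (assignmentVA A) hst f).trans (PS.eval_of_stK hst Q f)
  · intro h V hV H
    rw [PS.eval_of_stK hV, PS.eval_of_stK hV, h]

theorem kCong_stK_iff (P Q : PS A) :
    KCong stK P Q ↔ ∀ f : A → Bool, PS.truth f P = PS.truth f Q := by
  constructor
  · rintro ⟨R, -, hR, h⟩
    exact (kEquiv_stK_iff P Q).1 (hR _ _ h)
  · intro h
    refine ⟨fun P Q => ∀ f, PS.truth f P = PS.truth f Q, ⟨⟨?_, ?_, ?_⟩, ?_⟩, ?_, h⟩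
    · exact fun _ _ => rfl
    · exact fun h f => (h f).symm
    · exact fun h₁ h₂ f => (h₁ f).trans (h₂ f)
    · intro x x' y y' z z' hx hy hz f
      simp only [PS.truth, hx f, hy f, hz f]
    · exact fun x y => (kEquiv_stK_iff x y).2

theorem Deriv.truth_eq {P Q : PS A} (h : Deriv StAx P Q) (f : A → Bool) :
    PS.truth f P = PS.truth f Q := by
  induction h with
  | ax h => cases h <;> simp only [PS.truth] <;> grind
  | cp1 => simp [PS.truth]
  | cp2 => simp [PS.truth]
  | cp3 => simp [PS.truth]
  | cp4 => simp only [PS.truth]; grind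
  | refl => rfl
  | symm _ ih => exact ih.symm
  | trans _ _ ih₁ ih₂ => exact ih₁.trans ih₂
  | congr _ _ _ ih₁ ih₂ ih₃ => simp only [PS.truth, ih₁, ih₂, ih₃]

namespace Deriv

/-- Conditional composition over a negated condition swaps the branches. -/
theorem cond_not {Ax : PS A → PS A → Prop} (x y z : PS A) :
    Deriv Ax (.cond x (.cond .ff y .tt) z) (.cond z y x) :=
  (cp4 ..).trans (.congr (cp2 ..) (.refl _) (cp1 ..))

theorem stat_left (x y z u v : PS A) :
    Deriv StAx (.cond (.cond x y z) u v) (.cond (.cond x u v) y (.cond z u v)) :=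
  .ax (.stat ..)

theorem stat_right (x y z u v : PS A) :
    Deriv StAx (.cond v u (.cond x y z)) (.cond (.cond v u x) y (.cond v u z)) :=
  (cond_not ..).symm.trans <| (stat_left ..).trans <|
    .congr (cond_not ..) (.refl _) (cond_not ..)

theorem contr_left (x y z u : PS A) :
    Deriv StAx (.cond (.cond x y z) y u) (.cond x y u) :=
  .ax (.contr ..)

theorem contr_right (x y z u : PS A) :
    Deriv StAx (.cond u y (.cond x y z)) (.cond u y z) :=
  (cond_not ..).symm.trans <| (congr (cond_not ..).symm (.refl _) (.refl _)).trans <|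
    (contr_left ..).trans (cond_not ..)

theorem cond_self (x y : PS A) : Deriv StAx (.cond x y x) x :=
  (Deriv.congr (cp2 .tt x) (.refl _) (cp2 .tt x)).symm.trans <|
    (stat_left .tt y .tt .ff x).symm.trans (cp2 ..)

theorem contr_both (x y z u v : PS A) :
    Deriv StAx (.cond (.cond x y z) y (.cond u y v)) (.cond x y v) :=
  (contr_left ..).trans (contr_right ..)

/-- Conditional composition acts branchwise on statements conditioned on `y`. -/
theorem cond_cond (p₁ p₀ q₁ q₀ r₁ r₀ y : PS A) :
    Deriv StAx (.cond (.cond p₁ y p₀) (.cond q₁ y q₀) (.cond r₁ y r₀))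
      (.cond (.cond p₁ q₁ r₁) y (.cond p₀ q₀ r₀)) := by
  have key (q : PS A) : Deriv StAx (.cond (.cond p₁ y p₀) q (.cond r₁ y r₀))
      (.cond (.cond p₁ q r₁) y (.cond p₀ q r₀)) :=
    (stat_left ..).trans <|
      (congr (stat_right ..) (.refl _) (stat_right ..)).trans (contr_both ..)
  exact (cp4 ..).trans <| (congr (key q₁) (.refl _) (key q₀)).trans (contr_both ..)

/-- Shannon expansion with respect to an atom. -/
theorem shannon (a : A) (P : PS A) :
    Deriv StAx P (.cond (PS.subst a true P) (.atom a) (PS.subst a false P)) := by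
  induction P with
  | tt => exact (cond_self ..).symm
  | ff => exact (cond_self ..).symm
  | atom b =>
    by_cases h : b = a
    · subst h
      simpa [PS.subst, PS.const] using (cp3 (PS.atom b)).symm
    · simpa [PS.subst, h] using (cond_self (PS.atom b) (PS.atom a)).symm
  | cond p q r hp hq hr => exact (congr hp hq hr).trans (cond_cond ..)

theorem const_of_atoms_eq_nil (f : A → Bool) (P : PS A) (hP : PS.atoms P = []) :
    Deriv StAx P (PS.const (PS.truth f P)) := by
  induction P with
  | tt => exact .refl _
  | ff => exact .refl _
  | atom b => simp [PS.atoms] at hP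
  | cond p q r hp hq hr =>
    simp only [PS.atoms, List.append_eq_nil_iff] at hP
    refine (congr (hp hP.1.1) (hq hP.1.2) (hr hP.2)).trans ?_
    rw [PS.truth]
    cases PS.truth f q
    · exact cp2 ..
    · exact cp1 ..

end Deriv

open Classical in
theorem PS.truth_subst (f : A → Bool) (a : A) (b : Bool) (P : PS A) :
    PS.truth f (PS.subst a b P) = PS.truth (Function.update f a b) P := by
  induction P with
  | tt => rfl
  | ff => rfl
  | atom c =>
    by_cases h : c = a
    · subst h
      cases b <;> simp [PS.subst, PS.const, PS.truth]
    · simp [PS.subst, PS.truth, h]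
  | cond p q r hp hq hr => simp only [PS.subst, PS.truth, hp, hq, hr]

theorem PS.mem_atoms_subst {a c : A} {b : Bool} {P : PS A} (h : c ∈ PS.atoms (PS.subst a b P)) :
    c ∈ PS.atoms P ∧ c ≠ a := by
  induction P with
  | tt => simp [PS.subst, PS.atoms] at h
  | ff => simp [PS.subst, PS.atoms] at h
  | atom d =>
    by_cases hd : d = a
    · cases b <;> simp [PS.subst, PS.const, PS.atoms, hd] at h
    · simp only [PS.subst, hd, if_false, PS.atoms, List.mem_singleton] at h ⊢
      exact ⟨h, h ▸ hd⟩
  | cond p q r hp hq hr =>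
    simp only [PS.subst, PS.atoms, List.mem_append] at h ⊢
    tauto

theorem Deriv.of_truth_eq (l : List A) (P Q : PS A) (hP : PS.atoms P ⊆ l) (hQ : PS.atoms Q ⊆ l)
    (h : ∀ f, PS.truth f P = PS.truth f Q) : Deriv StAx P Q := by
  induction l generalizing P Q with
  | nil =>
    have hP' := const_of_atoms_eq_nil (fun _ => true) P (List.subset_nil.1 hP)
    have hQ' := const_of_atoms_eq_nil (fun _ => true) Q (List.subset_nil.1 hQ)
    rw [h] at hP'
    exact hP'.trans hQ'.symm
  | cons a l ih =>
    have sub {R : PS A} (hR : PS.atoms R ⊆ a :: l) (b : Bool) :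
        PS.atoms (PS.subst a b R) ⊆ l := fun c hc =>
      have hc' := PS.mem_atoms_subst hc
      (List.mem_cons.1 (hR hc'.1)).resolve_left hc'.2
    have step (b : Bool) : Deriv StAx (PS.subst a b P) (PS.subst a b Q) :=
      ih _ _ (sub hP b) (sub hQ b) fun f => by rw [PS.truth_subst, PS.truth_subst, h]
    exact (shannon a P).trans <| (congr (step true) (.refl _) (step false)).trans
      (shannon a Q).symm

/-- **Hoare's axiomatization of static valuation congruence**:
`CP_st ⊢ P = Q` if and only if `P =_st Q`. -/
theorem cp_st_axiomatization {A : Type} [Countable A] [Nontrivial A]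
    (P Q : PS A) : Deriv StAx P Q ↔ KCong stK P Q := by
  rw [kCong_stK_iff]
  exact ⟨Deriv.truth_eq, Deriv.of_truth_eq (PS.atoms P ++ PS.atoms Q) P Q
    (List.subset_append_left _ _) (List.subset_append_right _ _)⟩
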